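/- (Shuffle product identity.) Let γ : [a,b] → ℝ^d be a C¹ path, and let u = (u₁,…,u_m) and v = (v₁,…,vₙ) be words over {1,…,d}. Then S^u_{a,b}(γ) · S^v_{a,b}(γ) = Σ_{s} S^{w(s)}_{a,b}(γ), where the sum is over all subsets s ⊆ {1,…,m+n} with |s| = m, and w(s) is the word of length m+n that places the letters of u (in order) at the positions of s and the letters of v (in order) at the remaining positions. That is, the pointwise product of two coordinate iterated integrals is the coordinate iterated integral of the shuffle product of the words. -/

import Mathlib

open MeasureTheory intervalIntegral Set Filter

/-- Signature coefficients of a path, indexed by words over `Fin d`. -/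
noncomputable def sig {d : ℕ} (γ : ℝ → EuclideanSpace ℝ (Fin d)) :
    List (Fin d) → ℝ → ℝ → ℝ
  | [], _, _ => 1
  | i :: w, s, t => ∫ u in s..t, deriv γ u i * sig γ w u t

/-- Given words `u, v` and a subset `s` of the positions `{0,…,m+n-1}` (where
`m = |u|`, `n = |v|`), the interleaved word placing the letters of `u` in order
at the positions of `s` and the letters of `v` in order at the remaining
positions. -/
def shuffleWord {α : Type*} (u v : List α) (s : Finset (Fin (u.length + v.length))) :
    List α :=
  (List.finRange (u.length + v.length)).filterMap fun p =>
    if p ∈ s then u[(s.filter (fun q => q < p)).card]?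
    else v[((sᶜ : Finset (Fin (u.length + v.length))).filter (fun q => q < p)).card]?

/-- The word of `shuffleWord`, with a number of positions not tied to the lengths of the words. -/
def interleave {α : Type*} {N : ℕ} (u v : List α) (s : Finset (Fin N)) : List α :=
  (List.finRange N).filterMap fun p =>
    if p ∈ s then u[(s.filter (fun q => q < p)).card]?
    else v[((sᶜ : Finset (Fin N)).filter (fun q => q < p)).card]?

theorem card_filter_lt_map_succ {N : ℕ} (s : Finset (Fin N)) (p : Fin N) :
    ((s.map (Fin.succEmb N)).filter (fun q => q < p.succ)).card =
      (s.filter (fun q => q < p)).card := by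
  rw [Finset.filter_map, Finset.card_map]
  congr 1
  ext q
  rw [Finset.mem_filter, Finset.mem_filter]
  simp

theorem card_filter_lt_insert_zero_map_succ {N : ℕ} (s : Finset (Fin N)) (p : Fin N) :
    ((insert 0 (s.map (Fin.succEmb N))).filter (fun q => q < p.succ)).card =
      (s.filter (fun q => q < p)).card + 1 := by
  rw [Finset.filter_insert, if_pos (Fin.succ_pos p), Finset.card_insert_of_notMem (by simp),
    card_filter_lt_map_succ]

theorem univ_eq_insert_zero_map_succ (N : ℕ) :
    (Finset.univ : Finset (Fin (N + 1))) = insert 0 (Finset.univ.map (Fin.succEmb N)) := by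
  ext p
  cases p using Fin.cases <;> simp

theorem compl_map_succ {N : ℕ} (s : Finset (Fin N)) :
    (s.map (Fin.succEmb N))ᶜ = insert 0 (sᶜ.map (Fin.succEmb N)) := by
  ext p
  cases p using Fin.cases <;> simp

theorem compl_insert_zero_map_succ {N : ℕ} (s : Finset (Fin N)) :
    (insert 0 (s.map (Fin.succEmb N)))ᶜ = sᶜ.map (Fin.succEmb N) := by
  ext p
  cases p using Fin.cases <;> simp

theorem interleave_insert_zero {α : Type*} {N : ℕ} (i : α) (u v : List α) (s : Finset (Fin N)) :
    interleave (i :: u) v (insert 0 (s.map (Fin.succEmb N))) = i :: interleave u v s := by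
  unfold interleave
  rw [List.finRange_succ, List.filterMap_cons_some (b := i) (by simp), List.filterMap_map]
  congr 2
  funext p
  simp only [Function.comp_apply, card_filter_lt_insert_zero_map_succ,
    compl_insert_zero_map_succ, card_filter_lt_map_succ]
  simp

theorem interleave_map_succ {α : Type*} {N : ℕ} (j : α) (u v : List α) (s : Finset (Fin N)) :
    interleave u (j :: v) (s.map (Fin.succEmb N)) = j :: interleave u v s := by
  unfold interleave
  rw [List.finRange_succ, List.filterMap_cons_some (b := j) (by simp), List.filterMap_map]
  congr 2
  funext p
  simp only [Function.comp_apply, compl_map_succ, card_filter_lt_insert_zero_map_succ,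
    card_filter_lt_map_succ]
  simp

theorem interleave_nil_left {α : Type*} (v : List α) :
    interleave [] v (∅ : Finset (Fin v.length)) = v := by
  induction v with
  | nil => rfl
  | cons j v ih =>
    have h := interleave_map_succ j [] v (∅ : Finset (Fin v.length))
    rwa [Finset.map_empty, ih] at h

theorem interleave_nil_right {α : Type*} (u : List α) :
    interleave u [] (Finset.univ : Finset (Fin u.length)) = u := by
  induction u with
  | nil => rfl
  | cons i u ih =>
    have h := interleave_insert_zero i u [] (Finset.univ : Finset (Fin u.length))
    rwa [ih, ← univ_eq_insert_zero_map_succ] at h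

theorem sum_powersetCard_succ_univ {M : Type*} [AddCommMonoid M] {N : ℕ} (k : ℕ)
    (f : Finset (Fin (N + 1)) → M) :
    ∑ s ∈ Finset.powersetCard (k + 1) Finset.univ, f s =
      ∑ s ∈ Finset.powersetCard k Finset.univ, f (insert 0 (s.map (Fin.succEmb N))) +
        ∑ s ∈ Finset.powersetCard (k + 1) Finset.univ, f (s.map (Fin.succEmb N)) := by
  have h0 : (0 : Fin (N + 1)) ∉ Finset.univ.map (Fin.succEmb N) := by simp
  have hmem : ∀ {j : ℕ} {s : Finset (Fin (N + 1))},
      s ∈ Finset.powersetCard j (Finset.univ.map (Fin.succEmb N)) → 0 ∉ s :=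
    fun hs h => h0 ((Finset.mem_powersetCard.mp hs).1 h)
  rw [univ_eq_insert_zero_map_succ, Finset.powersetCard_succ_insert h0, Finset.sum_union, add_comm, Finset.sum_image]
  · simp only [Finset.powersetCard_map, Finset.sum_map]
    rfl
  · intro s hs t ht hst
    rw [← Finset.erase_insert (hmem hs), ← Finset.erase_insert (hmem ht), hst]
  · rw [Finset.disjoint_left]
    intro s hs hs'
    obtain ⟨t, -, rfl⟩ := Finset.mem_image.mp hs'
    exact hmem hs (Finset.mem_insert_self _ _)

section Signature

variable {d : ℕ} {γ : ℝ → EuclideanSpace ℝ (Fin d)}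

theorem continuous_deriv_coord (hγ : ContDiff ℝ 1 γ) (i : Fin d) :
    Continuous fun x => deriv γ x i := by
  have h : Continuous (deriv γ) := hγ.continuous_deriv le_rfl
  fun_prop

theorem continuous_sig (hγ : ContDiff ℝ 1 γ) (w : List (Fin d)) (b : ℝ) :
    Continuous fun x => sig γ w x b := by
  induction w with
  | nil => exact continuous_const
  | cons i w ih =>
    have hc : Continuous fun x => deriv γ x i * sig γ w x b :=
      (continuous_deriv_coord hγ i).mul ih
    simp only [sig, integral_symm b]
    exact (continuous_primitive (fun _ _ => hc.intervalIntegrable _ _) b).neg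

theorem hasDerivAt_sig_cons (hγ : ContDiff ℝ 1 γ) (i : Fin d) (w : List (Fin d)) (b x : ℝ) :
    HasDerivAt (fun y => sig γ (i :: w) y b) (-(deriv γ x i * sig γ w x b)) x := by
  have hc : Continuous fun x => deriv γ x i * sig γ w x b :=
    (continuous_deriv_coord hγ i).mul (continuous_sig hγ w b)
  exact integral_hasDerivAt_left (hc.intervalIntegrable _ _)
    (hc.stronglyMeasurableAtFilter _ _) hc.continuousAt

theorem sig_cons_mul_sig_cons (hγ : ContDiff ℝ 1 γ) (i j : Fin d) (u v : List (Fin d))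
    (a b : ℝ) :
    sig γ (i :: u) a b * sig γ (j :: v) a b =
      (∫ x in a..b, deriv γ x i * (sig γ u x b * sig γ (j :: v) x b)) +
        ∫ x in a..b, deriv γ x j * (sig γ (i :: u) x b * sig γ v x b) := by
  have hi := continuous_deriv_coord hγ i
  have hj := continuous_deriv_coord hγ j
  have hu := continuous_sig hγ u b
  have hv := continuous_sig hγ v b
  have hiu := continuous_sig hγ (i :: u) b
  have hjv := continuous_sig hγ (j :: v) b
  have hl : Continuous fun x => deriv γ x i * (sig γ u x b * sig γ (j :: v) x b) :=
    hi.mul (hu.mul hjv)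
  have hr : Continuous fun x => deriv γ x j * (sig γ (i :: u) x b * sig γ v x b) :=
    hj.mul (hiu.mul hv)
  have hd : ∀ x, HasDerivAt (fun y => -(sig γ (i :: u) y b * sig γ (j :: v) y b))
      (deriv γ x i * (sig γ u x b * sig γ (j :: v) x b) +
        deriv γ x j * (sig γ (i :: u) x b * sig γ v x b)) x := fun x => by
    refine ((hasDerivAt_sig_cons hγ i u b x).mul
      (hasDerivAt_sig_cons hγ j v b x)).neg.congr_deriv ?_
    ring
  rw [← integral_add (hl.intervalIntegrable _ _) (hr.intervalIntegrable _ _),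
    integral_eq_sub_of_hasDerivAt (fun x _ => hd x) ((hl.add hr).intervalIntegrable _ _)]
  simp [sig]

theorem integral_deriv_mul_sum_sig (hγ : ContDiff ℝ 1 γ) {ι : Type*} (S : Finset ι)
    (W : ι → List (Fin d)) (i : Fin d) (a b : ℝ) :
    ∫ x in a..b, deriv γ x i * ∑ s ∈ S, sig γ (W s) x b = ∑ s ∈ S, sig γ (i :: W s) a b := by
  simp only [Finset.mul_sum, sig]
  exact integral_finsetSum fun s _ =>
    ((continuous_deriv_coord hγ i).mul (continuous_sig hγ (W s) b)).intervalIntegrable _ _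

theorem sig_mul_sig_eq_sum_interleave (hγ : ContDiff ℝ 1 γ) (b : ℝ) {N : ℕ}
    (u v : List (Fin d)) (hN : N = u.length + v.length) (a : ℝ) :
    sig γ u a b * sig γ v a b =
      ∑ s ∈ Finset.powersetCard u.length (Finset.univ : Finset (Fin N)),
        sig γ (interleave u v s) a b := by
  induction N generalizing u v a with
  | zero =>
    obtain rfl : u = [] := List.length_eq_zero_iff.mp (by omega)
    obtain rfl : v = [] := List.length_eq_zero_iff.mp (by omega)
    simp [sig, interleave]
  | succ N ih =>
    match u, v with
    | [], v =>
      obtain hv : N + 1 = v.length := by simpa using hN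
      rw [hv]
      simp [sig, interleave_nil_left]
    | i :: u, [] =>
      obtain hu : N + 1 = (i :: u).length := by simpa using hN
      rw [hu]
      have h := Finset.powersetCard_self (Finset.univ : Finset (Fin (i :: u).length))
      rw [Finset.card_fin] at h
      rw [h, Finset.sum_singleton, interleave_nil_right, sig.eq_1, mul_one]
    | i :: u, j :: v =>
      simp only [List.length_cons] at hN
      rw [sig_cons_mul_sig_cons hγ, List.length_cons, sum_powersetCard_succ_univ]
      simp only [ih u (j :: v) (by simp; omega), ih (i :: u) v (by simp; omega),
        integral_deriv_mul_sum_sig hγ, interleave_insert_zero, interleave_map_succ,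
        List.length_cons]

end Signature

/-- Shuffle product identity: the pointwise product of two coordinate iterated
integrals is the sum of the coordinate iterated integrals over all shuffles of
the two words, i.e. over all subsets `s` of `{0,…,m+n-1}` of cardinality `m`. -/
theorem signature_shuffle_product {d : ℕ}
    (γ : ℝ → EuclideanSpace ℝ (Fin d)) (a b : ℝ) (hab : a ≤ b)
    (hγ : ContDiff ℝ 1 γ) (u v : List (Fin d)) :
    sig γ u a b * sig γ v a b =
      ∑ s ∈ Finset.powersetCard u.length
          (Finset.univ : Finset (Fin (u.length + v.length))),
        sig γ (shuffleWord u v s) a b := by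
  exact sig_mul_sig_eq_sum_interleave hγ b u v rfl a
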